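/- Let T > 0 and let u, p, V, γ satisfy all the hypotheses of the basic energy law: u : [0,T] × ℝ² → ℝ², p : [0,T] × ℝ² → ℝ, V : [0,T] × ℝ² → Matrix (Fin 2) (Fin 2) ℝ symmetric-valued and γ : [0,T] × ℝ² → ℝ are C², compactly supported in the spatial variable uniformly in t, and satisfy pointwise ∇·u = 0, ∂_t u + (u·∇)u + ∇p = Δu + ∇·(V Vᵀ) + 2 ∇·V, and ∂_t V + (u·∇)V = S(u) + ½((∇u) V + V (∇u)ᵀ) + ½(ω₁₂(u) − γ)(V A − A V). Assume in addition that det(I₂ + V(t,x)) = 1 for all (t,x). Then for every t ∈ [0,T]: ∫₀^t ∫_{ℝ²} |∇u(s,x)|² dx ds ≤ ‖u(0,·)‖_{L²}² + ‖V(0,·)‖_{L²}², where ‖V(0,·)‖_{L²}² = ∫_{ℝ²} Σ_{i,j} V_{ij}(0,x)² dx. -/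

import Mathlib

open Matrix MeasureTheory

/-- The spatial partial derivative in the `i`-th coordinate direction of a
scalar function of time and space. -/
noncomputable def pds (i : Fin 2) (f : ℝ × (Fin 2 → ℝ) → ℝ) (t : ℝ)
    (x : Fin 2 → ℝ) : ℝ :=
  fderiv ℝ (fun y => f (t, y)) x (Pi.single i 1)

/-- The spatial gradient matrix of a time-dependent vector field:
`(∇u)_{ij} = ∂_i u_j`. -/
noncomputable def gradMats (u : ℝ × (Fin 2 → ℝ) → (Fin 2 → ℝ)) (t : ℝ)
    (x : Fin 2 → ℝ) : Matrix (Fin 2) (Fin 2) ℝ :=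
  Matrix.of fun i j => pds i (fun q => u q j) t x

/-- The spatial divergence of a time-dependent matrix field:
`(∇·M)_j = Σ_i ∂_i M_{ij}`. -/
noncomputable def matDivs (M : ℝ × (Fin 2 → ℝ) → Matrix (Fin 2) (Fin 2) ℝ)
    (t : ℝ) (x : Fin 2 → ℝ) : Fin 2 → ℝ :=
  fun j => ∑ i, pds i (fun q => M q i j) t x

/-- The constant rotation matrix `A = [[0, -1], [1, 0]]`. -/
def Arot : Matrix (Fin 2) (Fin 2) ℝ := !![0, -1; 1, 0]


noncomputable def Dv (v : ℝ × (Fin 2 → ℝ)) (f : ℝ × (Fin 2 → ℝ) → ℝ)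
    (q : ℝ × (Fin 2 → ℝ)) : ℝ := fderiv ℝ f q v

lemma pds_eq (i : Fin 2) {f : ℝ × (Fin 2 → ℝ) → ℝ} (hf : Differentiable ℝ f) (t : ℝ)
    (x : Fin 2 → ℝ) : pds i f t x = Dv (0, Pi.single i 1) f (t, x) := by
  have h1 : HasFDerivAt (fun y : Fin 2 → ℝ => (t, y))
      (ContinuousLinearMap.inr ℝ ℝ (Fin 2 → ℝ)) x := hasFDerivAt_prodMk_right t x
  have h2 := (hf (t, x)).hasFDerivAt.comp x h1
  have h3 : fderiv ℝ (fun y => f (t, y)) x = _ := h2.fderiv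
  unfold pds Dv
  rw [h3]
  simp

lemma hasDerivAt_time {f : ℝ × (Fin 2 → ℝ) → ℝ} (hf : Differentiable ℝ f) (t : ℝ)
    (x : Fin 2 → ℝ) : HasDerivAt (fun s => f (s, x)) (Dv (1, 0) f (t, x)) t := by
  have h1 : HasFDerivAt (fun s : ℝ => (s, x))
      (ContinuousLinearMap.inl ℝ ℝ (Fin 2 → ℝ)) t := hasFDerivAt_prodMk_left t x
  have h2 := ((hf (t, x)).hasFDerivAt.comp t h1).hasDerivAt
  have h3 : HasDerivAt (fun s => f (s, x)) _ t := h2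
  convert h3 using 1
  simp [Dv]

lemma Dv_add (v) {f g : ℝ × (Fin 2 → ℝ) → ℝ} (hf : Differentiable ℝ f)
    (hg : Differentiable ℝ g) (q) :
    Dv v (fun r => f r + g r) q = Dv v f q + Dv v g q := by
  unfold Dv
  rw [fderiv_fun_add (hf q) (hg q)]
  simp

lemma Dv_sub (v) {f g : ℝ × (Fin 2 → ℝ) → ℝ} (hf : Differentiable ℝ f)
    (hg : Differentiable ℝ g) (q) :
    Dv v (fun r => f r - g r) q = Dv v f q - Dv v g q := by
  unfold Dv
  rw [fderiv_fun_sub (hf q) (hg q)]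
  simp

lemma Dv_mul (v) {f g : ℝ × (Fin 2 → ℝ) → ℝ} (hf : Differentiable ℝ f)
    (hg : Differentiable ℝ g) (q) :
    Dv v (fun r => f r * g r) q = f q * Dv v g q + g q * Dv v f q := by
  unfold Dv
  rw [fderiv_fun_mul (hf q) (hg q)]
  simp

lemma Dv_const (v) (c : ℝ) (q) : Dv v (fun _ => c) q = 0 := by
  simp [Dv]

lemma Dv_contDiff (v) {f : ℝ × (Fin 2 → ℝ) → ℝ} (hf : ContDiff ℝ 2 f) :
    ContDiff ℝ 1 (Dv v f) :=
  (hf.fderiv_right (m := 1) (by norm_num)).clm_apply contDiff_const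

lemma Dv_cont (v) {f : ℝ × (Fin 2 → ℝ) → ℝ} (hf : ContDiff ℝ 1 f) :
    Continuous (Dv v f) :=
  (hf.continuous_fderiv (by norm_num)).clm_apply continuous_const

lemma Dv_supp (v) {f : ℝ × (Fin 2 → ℝ) → ℝ} {K : Set (Fin 2 → ℝ)} (hK : IsCompact K)
    (h : ∀ t x, x ∉ K → f (t, x) = 0) (t : ℝ) (x : Fin 2 → ℝ) (hx : x ∉ K) :
    Dv v f (t, x) = 0 := by
  have : f =ᶠ[nhds (t, x)] fun _ => 0 := by
    have ho : IsOpen {q : ℝ × (Fin 2 → ℝ) | q.2 ∉ K} :=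
      hK.isClosed.isOpen_compl.preimage continuous_snd
    filter_upwards [ho.mem_nhds (show (t, x) ∈ _ from hx)] with q hq
    exact h q.1 q.2 hq
  unfold Dv
  rw [this.fderiv_eq]
  simp

lemma slice_int {f : ℝ × (Fin 2 → ℝ) → ℝ} {K : Set (Fin 2 → ℝ)} (hK : IsCompact K)
    (hf : Continuous f) (h : ∀ t x, x ∉ K → f (t, x) = 0) (t : ℝ) :
    Integrable (fun x => f (t, x)) := by
  apply Continuous.integrable_of_hasCompactSupport (by fun_prop)
  exact HasCompactSupport.intro hK (fun x hx => h t x hx)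

lemma slice_div {f : ℝ × (Fin 2 → ℝ) → ℝ} {K : Set (Fin 2 → ℝ)} (hK : IsCompact K)
    (hf : ContDiff ℝ 1 f) (h : ∀ t x, x ∉ K → f (t, x) = 0) (t : ℝ) (i : Fin 2) :
    ∫ x, Dv (0, Pi.single i 1) f (t, x) = 0 := by
  have hd := hf.differentiable (by norm_num)
  have hi := slice_int hK (Dv_cont (0, Pi.single i 1) hf) (Dv_supp _ hK h) t
  have hi0 := slice_int hK hf.continuous h t
  have e : ∀ x, Dv (0, Pi.single i 1) f (t, x)
      = fderiv ℝ (fun y => f (t, y)) x (Pi.single i 1) := fun x => (pds_eq i hd t x).symm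
  simp_rw [e] at hi ⊢
  have := integral_mul_fderiv_eq_neg_fderiv_mul_of_integrable (μ := volume)
    (f := fun _ : Fin 2 → ℝ => (1 : ℝ)) (g := fun y => f (t, y)) (v := Pi.single i 1)
    (by simp) (by simpa using hi) (by simpa using hi0) (by intros; fun_prop)
    (by intros; fun_prop)
  simpa using this

lemma final {e N G0 G1 : ℝ × (Fin 2 → ℝ) → ℝ} {K : Set (Fin 2 → ℝ)} (hK : IsCompact K)
    (he : ContDiff ℝ 1 e) (hG0 : ContDiff ℝ 1 G0) (hG1 : ContDiff ℝ 1 G1)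
    (se : ∀ t x, x ∉ K → e (t, x) = 0) (s0 : ∀ t x, x ∉ K → G0 (t, x) = 0)
    (s1 : ∀ t x, x ∉ K → G1 (t, x) = 0) {t : ℝ} (ht : 0 ≤ t)
    (h : ∀ s ∈ Set.Icc 0 t, ∀ x, N (s, x) = Dv (0, Pi.single 0 1) G0 (s, x)
      + Dv (0, Pi.single 1 1) G1 (s, x) - Dv (1, 0) e (s, x)) :
    ∫ s in (0:ℝ)..t, ∫ x, N (s, x) = (∫ x, e (0, x)) - ∫ x, e (t, x) := by
  have A : ∀ s ∈ Set.uIcc 0 t, ∫ x, N (s, x) = - ∫ x, Dv (1, 0) e (s, x) := by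
    intro s hs
    rw [Set.uIcc_of_le ht] at hs
    simp_rw [h s hs]
    have i0 := slice_int hK (Dv_cont (0, Pi.single 0 1) hG0) (Dv_supp _ hK s0) s
    have i1 := slice_int hK (Dv_cont (0, Pi.single 1 1) hG1) (Dv_supp _ hK s1) s
    have i2 := slice_int hK (Dv_cont (1, 0) he) (Dv_supp _ hK se) s
    rw [integral_sub (by exact i0.add i1) i2, integral_add i0 i1, slice_div hK hG0 s0,
      slice_div hK hG1 s1]
    simp
  rw [intervalIntegral.integral_congr A, intervalIntegral.integral_neg,
    intervalIntegral_integral_swap (f := fun s x => Dv (1, 0) e (s, x))]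
  · have B : ∀ x, ∫ s in (0:ℝ)..t, Dv (1, 0) e (s, x) = e (t, x) - e (0, x) := by
      intro x
      apply intervalIntegral.integral_eq_sub_of_hasDerivAt
      · intro s _
        exact hasDerivAt_time (he.differentiable (by norm_num)) s x
      · apply Continuous.intervalIntegrable
        exact (Dv_cont _ he).comp (by fun_prop)
    simp_rw [B]
    rw [integral_sub (slice_int hK he.continuous se t) (slice_int hK he.continuous se 0)]
    ring
  · have : (volume.restrict (Set.uIoc 0 t)).prod (volume : Measure (Fin 2 → ℝ))
        = (volume.prod volume).restrict (Set.uIoc 0 t ×ˢ Set.univ) := by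
      rw [← Measure.prod_restrict, Measure.restrict_univ]
    rw [this]
    have c : IntegrableOn (Dv (1, 0) e) (Set.uIcc 0 t ×ˢ K) (volume.prod volume) :=
      (Dv_cont (1, 0) he).continuousOn.integrableOn_compact (isCompact_uIcc.prod hK)
    have c' : IntegrableOn (Dv (1, 0) e) (Set.uIoc 0 t ×ˢ Set.univ) (volume.prod volume) := by
      refine c.of_forall_sdiff_eq_zero (measurableSet_uIoc.prod MeasurableSet.univ) ?_
      rintro ⟨s, x⟩ ⟨⟨hs, _⟩, hx⟩
      apply Dv_supp _ hK se
      intro hxK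
      exact hx ⟨Set.uIoc_subset_uIcc hs, hxK⟩
    exact c'

/-- Under the hypotheses of the basic energy law, together with
`det (I₂ + V) = 1`, the space-time integral of `|∇u|²` up to time `t` is
bounded by `‖u(0,·)‖_{L²}² + ‖V(0,·)‖_{L²}²`. -/
theorem spacetime_gradient_bound (T : ℝ) (hT : 0 < T)
    (u : ℝ × (Fin 2 → ℝ) → (Fin 2 → ℝ)) (p : ℝ × (Fin 2 → ℝ) → ℝ)
    (V : ℝ × (Fin 2 → ℝ) → Matrix (Fin 2) (Fin 2) ℝ)
    (γ : ℝ × (Fin 2 → ℝ) → ℝ)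
    (hu : ∀ j, ContDiff ℝ 2 fun q => u q j) (hp : ContDiff ℝ 2 p)
    (hV : ∀ i j, ContDiff ℝ 2 fun q => V q i j) (hγ : ContDiff ℝ 2 γ)
    (hsym : ∀ t x, (V (t, x))ᵀ = V (t, x))
    (hsupp : ∃ K : Set (Fin 2 → ℝ), IsCompact K ∧ ∀ t x, x ∉ K →
      u (t, x) = 0 ∧ p (t, x) = 0 ∧ V (t, x) = 0 ∧ γ (t, x) = 0)
    (hdiv : ∀ t ∈ Set.Icc (0 : ℝ) T, ∀ x,
      ∑ i, pds i (fun q => u q i) t x = 0)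
    (hmom : ∀ t ∈ Set.Icc (0 : ℝ) T, ∀ x (j : Fin 2),
      deriv (fun s => u (s, x) j) t
          + (∑ k, u (t, x) k * pds k (fun q => u q j) t x) + pds j p t x
        = (∑ i, pds i (fun q => pds i (fun r => u r j) q.1 q.2) t x)
            + matDivs (fun q => V q * (V q)ᵀ) t x j + 2 * matDivs V t x j)
    (hstrain : ∀ t ∈ Set.Icc (0 : ℝ) T, ∀ x (i j : Fin 2),
      deriv (fun s => V (s, x) i j) t
          + ∑ k, u (t, x) k * pds k (fun q => V q i j) t x
        = ((2⁻¹ : ℝ) • (gradMats u t x + (gradMats u t x)ᵀ)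
            + (2⁻¹ : ℝ) •
                (gradMats u t x * V (t, x) + V (t, x) * (gradMats u t x)ᵀ)
            + ((2⁻¹ : ℝ) * ((2⁻¹ : ℝ) *
                    (pds 1 (fun q => u q 0) t x - pds 0 (fun q => u q 1) t x)
                  - γ (t, x))) •
                (V (t, x) * Arot - Arot * V (t, x))) i j)
    (hdet : ∀ t ∈ Set.Icc (0 : ℝ) T, ∀ x, (1 + V (t, x)).det = 1) :
    ∀ t ∈ Set.Icc (0 : ℝ) T,
      (∫ s in (0 : ℝ)..t,
          ∫ x : Fin 2 → ℝ, ∑ i, ∑ j, (pds i (fun q => u q j) s x) ^ 2)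
        ≤ (∫ x : Fin 2 → ℝ, ∑ i, (u (0, x) i) ^ 2)
            + ∫ x : Fin 2 → ℝ, ∑ i, ∑ j, (V (0, x) i j) ^ 2 := by
  
  obtain ⟨K, hK, hsupp⟩ := hsupp
  have hb : ∀ q, V q 1 0 = V q 0 1 := fun q => by
    have := congrFun (congrFun (hsym q.1 q.2) 0) 1
    simpa [Matrix.transpose_apply] using this
  obtain ⟨u0, hu0⟩ : ∃ f : ℝ × (Fin 2 → ℝ) → ℝ, ∀ q, u q 0 = f q := ⟨_, fun _ => rfl⟩
  obtain ⟨u1, hu1⟩ : ∃ f : ℝ × (Fin 2 → ℝ) → ℝ, ∀ q, u q 1 = f q := ⟨_, fun _ => rfl⟩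
  obtain ⟨a, ha⟩ : ∃ f : ℝ × (Fin 2 → ℝ) → ℝ, ∀ q, V q 0 0 = f q := ⟨_, fun _ => rfl⟩
  obtain ⟨b, hb1⟩ : ∃ f : ℝ × (Fin 2 → ℝ) → ℝ, ∀ q, V q 0 1 = f q := ⟨_, fun _ => rfl⟩
  obtain ⟨c, hc⟩ : ∃ f : ℝ × (Fin 2 → ℝ) → ℝ, ∀ q, V q 1 1 = f q := ⟨_, fun _ => rfl⟩
  have cu0 := hu 0
  have cu1 := hu 1
  have ca := hV 0 0
  have cb := hV 0 1
  have cc := hV 1 1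
  simp only [hu0, hu1, ha, hb1, hc] at cu0 cu1 ca cb cc
  have hb2 : ∀ q, V q 1 0 = b q := fun q => (hb q).trans (hb1 q)
  have su0 : ∀ t x, x ∉ K → u0 (t, x) = 0 := fun t x hx => by
    rw [← hu0, (hsupp t x hx).1]; rfl
  have su1 : ∀ t x, x ∉ K → u1 (t, x) = 0 := fun t x hx => by
    rw [← hu1, (hsupp t x hx).1]; rfl
  have sa : ∀ t x, x ∉ K → a (t, x) = 0 := fun t x hx => by
    rw [← ha, (hsupp t x hx).2.2.1]; rfl
  have sb : ∀ t x, x ∉ K → b (t, x) = 0 := fun t x hx => by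
    rw [← hb1, (hsupp t x hx).2.2.1]; rfl
  have sc : ∀ t x, x ∉ K → c (t, x) = 0 := fun t x hx => by
    rw [← hc, (hsupp t x hx).2.2.1]; rfl
  have du0 := cu0.differentiable (by norm_num)
  have du1 := cu1.differentiable (by norm_num)
  have da := ca.differentiable (by norm_num)
  have db := cb.differentiable (by norm_num)
  have dc := cc.differentiable (by norm_num)
  have dp := hp.differentiable (by norm_num)
  have c1u0 : ContDiff ℝ 1 u0 := cu0.of_le (by norm_num)
  have c1u1 : ContDiff ℝ 1 u1 := cu1.of_le (by norm_num)
  have c1a : ContDiff ℝ 1 a := ca.of_le (by norm_num)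
  have c1b : ContDiff ℝ 1 b := cb.of_le (by norm_num)
  have c1c : ContDiff ℝ 1 c := cc.of_le (by norm_num)
  have c1p : ContDiff ℝ 1 p := hp.of_le (by norm_num)
  have cDu0 : ∀ v, ContDiff ℝ 1 (Dv v u0) := fun v => Dv_contDiff v cu0
  have cDu1 : ∀ v, ContDiff ℝ 1 (Dv v u1) := fun v => Dv_contDiff v cu1
  have dDu0 : ∀ v, Differentiable ℝ (Dv v u0) := fun v => (cDu0 v).differentiable (by norm_num)
  have dDu1 : ∀ v, Differentiable ℝ (Dv v u1) := fun v => (cDu1 v).differentiable (by norm_num)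
  have tm : ∀ {f : ℝ × (Fin 2 → ℝ) → ℝ}, Differentiable ℝ f → ∀ t x,
      deriv (fun s => f (s, x)) t = Dv (1, 0) f (t, x) :=
    fun hf t x => (hasDerivAt_time hf t x).deriv
  have pu0 : ∀ i t x, pds i u0 t x = Dv (0, Pi.single i 1) u0 (t, x) :=
    fun i t x => pds_eq i du0 t x
  have pu1 : ∀ i t x, pds i u1 t x = Dv (0, Pi.single i 1) u1 (t, x) :=
    fun i t x => pds_eq i du1 t x
  have pa : ∀ i t x, pds i a t x = Dv (0, Pi.single i 1) a (t, x) :=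
    fun i t x => pds_eq i da t x
  have pb : ∀ i t x, pds i b t x = Dv (0, Pi.single i 1) b (t, x) :=
    fun i t x => pds_eq i db t x
  have pc : ∀ i t x, pds i c t x = Dv (0, Pi.single i 1) c (t, x) :=
    fun i t x => pds_eq i dc t x
  have pp : ∀ i t x, pds i p t x = Dv (0, Pi.single i 1) p (t, x) :=
    fun i t x => pds_eq i dp t x
  have pDu0 : ∀ i v t x, pds i (fun q => Dv v u0 q) t x
      = Dv (0, Pi.single i 1) (Dv v u0) (t, x) := fun i v t x => pds_eq i (dDu0 v) t x
  have pDu1 : ∀ i v t x, pds i (fun q => Dv v u1 q) t x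
      = Dv (0, Pi.single i 1) (Dv v u1) (t, x) := fun i v t x => pds_eq i (dDu1 v) t x
  have pprod : ∀ {f g h k : ℝ × (Fin 2 → ℝ) → ℝ}, Differentiable ℝ f → Differentiable ℝ g →
      Differentiable ℝ h → Differentiable ℝ k → ∀ i t x,
      pds i (fun q => f q * g q + h q * k q) t x = f (t, x) * Dv (0, Pi.single i 1) g (t, x)
        + g (t, x) * Dv (0, Pi.single i 1) f (t, x) + (h (t, x) * Dv (0, Pi.single i 1) k (t, x)
        + k (t, x) * Dv (0, Pi.single i 1) h (t, x)) := by
    intro f g h k hf hg hh hk i t x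
    rw [pds_eq i (by fun_prop), Dv_add _ (by fun_prop) (by fun_prop), Dv_mul _ hf hg,
      Dv_mul _ hh hk]
  have M0 := fun t ht x => hmom t ht x 0
  have M1 := fun t ht x => hmom t ht x 1
  have S00 := fun t ht x => hstrain t ht x 0 0
  have S01 := fun t ht x => hstrain t ht x 0 1
  have S11 := fun t ht x => hstrain t ht x 1 1
  clear hmom hstrain
  simp only [matDivs, gradMats, Arot, Fin.sum_univ_two, Matrix.mul_apply, Matrix.transpose_apply,
    Matrix.add_apply, Matrix.sub_apply, Matrix.smul_apply, Matrix.of_apply, smul_eq_mul,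
    hu0, hu1, ha, hb1, hb2, hc, pu0, pu1, pa, pb, pc, pp, tm du0, tm du1, tm da, tm db, tm dc,
    Prod.mk.eta, pDu0, pDu1,
    pprod da da db db, pprod da db db dc, pprod db da dc db, pprod db db dc dc,
    Matrix.cons_val', Matrix.cons_val_zero, Matrix.cons_val_one, Matrix.cons_val_fin_one]
    at M0 M1 S00 S01 S11 hdiv
  have hdet' : ∀ t ∈ Set.Icc (0 : ℝ) T, ∀ x,
      (1 + a (t, x)) * (1 + c (t, x)) - b (t, x) * b (t, x) = 1 := by
    intro t ht x
    have := hdet t ht x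
    rw [Matrix.det_fin_two] at this
    simpa [ha, hb1, hb2, hc] using this
  intro t ht
  let e : ℝ × (Fin 2 → ℝ) → ℝ := fun q => (1/2) * (u0 q * u0 q + u1 q * u1 q + a q * a q
    + 2 * (b q * b q) + c q * c q) + (a q + c q)
  let N : ℝ × (Fin 2 → ℝ) → ℝ := fun q =>
    Dv (0, Pi.single 0 1) u0 q ^ 2 + Dv (0, Pi.single 0 1) u1 q ^ 2
    + (Dv (0, Pi.single 1 1) u0 q ^ 2 + Dv (0, Pi.single 1 1) u1 q ^ 2)
  let G0 : ℝ × (Fin 2 → ℝ) → ℝ := fun q =>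
    u0 q * Dv (0, Pi.single 0 1) u0 q + u1 q * Dv (0, Pi.single 0 1) u1 q
    + (u0 q * (a q * a q + b q * b q) + u1 q * (a q * b q + b q * c q))
    + 2 * (u0 q * a q + u1 q * b q)
    - u0 q * (((1/2) * (u0 q * u0 q + u1 q * u1 q + a q * a q
    + 2 * (b q * b q) + c q * c q) + (a q + c q)) + p q)
  let G1 : ℝ × (Fin 2 → ℝ) → ℝ := fun q =>
    u0 q * Dv (0, Pi.single 1 1) u0 q + u1 q * Dv (0, Pi.single 1 1) u1 q
    + (u0 q * (a q * b q + b q * c q) + u1 q * (b q * b q + c q * c q))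
    + 2 * (u0 q * b q + u1 q * c q)
    - u1 q * (((1/2) * (u0 q * u0 q + u1 q * u1 q + a q * a q
    + 2 * (b q * b q) + c q * c q) + (a q + c q)) + p q)
  have ce : ContDiff ℝ 1 e := by fun_prop
  have se : ∀ t x, x ∉ K → e (t, x) = 0 := fun t x hx => by
    simp [e, su0 t x hx, su1 t x hx, sa t x hx, sb t x hx, sc t x hx]
  have key := final (e := e) (N := N) (G0 := G0) (G1 := G1) hK ce
    (by fun_prop) (by fun_prop) se
    (fun t x hx => by simp [G0, su0 t x hx, su1 t x hx])
    (fun t x hx => by simp [G1, su0 t x hx, su1 t x hx])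
    ht.1 (by
      intro s hs x
      have hs' : s ∈ Set.Icc 0 T := ⟨hs.1, hs.2.trans ht.2⟩
      have m0 := M0 s hs' x
      have m1 := M1 s hs' x
      have s00 := S00 s hs' x
      have s01 := S01 s hs' x
      have s11 := S11 s hs' x
      have hd := hdiv s hs' x
      simp (disch := fun_prop) only [e, N, G0, G1, Dv_add, Dv_sub, Dv_mul, Dv_const]
      linear_combination u0 (s, x) * m0 + u1 (s, x) * m1 + (a (s, x) + 1) * s00
        + 2 * b (s, x) * s01 + (c (s, x) + 1) * s11
        + ((1/2) * (u0 (s, x) * u0 (s, x) + u1 (s, x) * u1 (s, x) + a (s, x) * a (s, x)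
          + 2 * (b (s, x) * b (s, x)) + c (s, x) * c (s, x)) + (a (s, x) + c (s, x))
          + p (s, x) + 1) * hd)
  have hLHS : (∫ s in (0 : ℝ)..t,
          ∫ x : Fin 2 → ℝ, ∑ i, ∑ j, (pds i (fun q => u q j) s x) ^ 2)
        = ∫ s in (0 : ℝ)..t, ∫ x, N (s, x) := by
    simp only [Fin.sum_univ_two, hu0, hu1, pu0, pu1, N]
  rw [hLHS, key]
  have hpos : 0 ≤ ∫ x, e (t, x) := by
    apply integral_nonneg
    intro x
    have := hdet' t ht x
    simp only [e, Pi.zero_apply]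
    nlinarith [sq_nonneg (a (t, x) - c (t, x)), sq_nonneg (b (t, x)), sq_nonneg (u0 (t, x)),
      sq_nonneg (u1 (t, x))]
  have hU : Integrable (fun x : Fin 2 → ℝ => ∑ i, (u (0, x) i) ^ 2) := by
    simp only [Fin.sum_univ_two, hu0, hu1]
    exact slice_int (f := fun q => u0 q ^ 2 + u1 q ^ 2) hK (by fun_prop)
      (fun t x hx => by simp [su0 t x hx, su1 t x hx]) 0
  have hW : Integrable (fun x : Fin 2 → ℝ => ∑ i, ∑ j, (V (0, x) i j) ^ 2) := by
    simp only [Fin.sum_univ_two, ha, hb1, hb2, hc]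
    exact slice_int (f := fun q => a q ^ 2 + b q ^ 2 + (b q ^ 2 + c q ^ 2)) hK (by fun_prop)
      (fun t x hx => by simp [sa t x hx, sb t x hx, sc t x hx]) 0
  have hle : ∫ x, e (0, x) ≤ (∫ x : Fin 2 → ℝ, ∑ i, (u (0, x) i) ^ 2)
            + ∫ x : Fin 2 → ℝ, ∑ i, ∑ j, (V (0, x) i j) ^ 2 := by
    rw [← integral_add hU hW]
    apply integral_mono (slice_int hK ce.continuous se 0) (hU.add hW)
    intro x
    have := hdet' 0 ⟨le_rfl, hT.le⟩ x
    simp only [Pi.add_apply, Fin.sum_univ_two, hu0, hu1, ha, hb1, hb2, hc, e]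
    nlinarith [sq_nonneg (a (0, x) + c (0, x)), sq_nonneg (u0 (0, x)), sq_nonneg (u1 (0, x))]
  linarith
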